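/- arXiv:2404.05708 — 3 statements merged into one kernel-verified Lean document; each statement's English description precedes it below -/
import Mathlib

section
/- The linear-memory row-update iteration computes the dynamic-programming matrix row by row: for every i < P and j < Q, v^{(i)}_j = M(i,j); in particular v^{(P−1)}_{Q−1} equals the discrete Fréchet distance δ_dF(p,q). -/
/-- A legal step of a coupling: advance in `p`, in `q`, or in both. -/
def FrechetStep {P Q : ℕ} (a b : Fin P × Fin Q) : Prop :=
  ((b.1 : ℕ) = (a.1 : ℕ) + 1 ∧ (b.2 : ℕ) = (a.2 : ℕ)) ∨
  ((b.1 : ℕ) = (a.1 : ℕ) ∧ (b.2 : ℕ) = (a.2 : ℕ) + 1) ∨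
  ((b.1 : ℕ) = (a.1 : ℕ) + 1 ∧ (b.2 : ℕ) = (a.2 : ℕ) + 1)

/-- A coupling between two sequences indexed by `Fin P` and `Fin Q`. -/
def IsCoupling {P Q : ℕ} (c : List (Fin P × Fin Q)) : Prop :=
  (∃ x ∈ c.head?, (x.1 : ℕ) = 0 ∧ (x.2 : ℕ) = 0) ∧
  (∃ y ∈ c.getLast?, (y.1 : ℕ) = P - 1 ∧ (y.2 : ℕ) = Q - 1) ∧
  List.Chain' FrechetStep c

/-- The maximal pointwise distance along a coupling. -/
noncomputable def couplingCost {E : Type*} [MetricSpace E] {P Q : ℕ}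
    (p : Fin P → E) (q : Fin Q → E) (c : List (Fin P × Fin Q)) : ℝ :=
  (c.map fun ij => dist (p ij.1) (q ij.2)).foldr max 0

/-- The discrete Fréchet distance: minimum over couplings of the maximal
pointwise distance along the coupling. -/
noncomputable def discreteFrechet {E : Type*} [MetricSpace E] {P Q : ℕ}
    (p : Fin P → E) (q : Fin Q → E) : ℝ :=
  sInf { r | ∃ c, IsCoupling c ∧ couplingCost p q c = r }

/-- `M` satisfies the dynamic-programming recursion of the discrete Fréchet distance. -/
structure IsFrechetTable {E : Type*} [MetricSpace E] {P Q : ℕ}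
    (p : Fin P → E) (q : Fin Q → E) (M : ℕ → ℕ → ℝ) : Prop where
  corner : ∀ (hP : 0 < P) (hQ : 0 < Q), M 0 0 = dist (p ⟨0, hP⟩) (q ⟨0, hQ⟩)
  left : ∀ i (hi : i + 1 < P) (hQ : 0 < Q),
    M (i + 1) 0 = max (M i 0) (dist (p ⟨i + 1, hi⟩) (q ⟨0, hQ⟩))
  top : ∀ j (hP : 0 < P) (hj : j + 1 < Q),
    M 0 (j + 1) = max (M 0 j) (dist (p ⟨0, hP⟩) (q ⟨j + 1, hj⟩))
  inner : ∀ i j (hi : i + 1 < P) (hj : j + 1 < Q),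
    M (i + 1) (j + 1) =
      max (min (M i (j + 1)) (min (M i j) (M (i + 1) j)))
        (dist (p ⟨i + 1, hi⟩) (q ⟨j + 1, hj⟩))

/-- Some chain of steps leads from `(0, 0)` to `b` through pairs at distance at most `r`. -/
def FrechetReachable {E : Type*} [MetricSpace E] {P Q : ℕ}
    (p : Fin P → E) (q : Fin Q → E) (r : ℝ) (b : Fin P × Fin Q) : Prop :=
  ∃ c : List (Fin P × Fin Q), (∃ x ∈ c.head?, (x.1 : ℕ) = 0 ∧ (x.2 : ℕ) = 0) ∧
    c.getLast? = some b ∧ c.IsChain FrechetStep ∧ ∀ z ∈ c, dist (p z.1) (q z.2) ≤ r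

section

variable {E : Type*} [MetricSpace E] {P Q : ℕ} {p : Fin P → E} {q : Fin Q → E}
  {M : ℕ → ℕ → ℝ} {r : ℝ}

theorem couplingCost_le_iff {c : List (Fin P × Fin Q)} :
    couplingCost p q c ≤ r ↔ 0 ≤ r ∧ ∀ z ∈ c, dist (p z.1) (q z.2) ≤ r := by
  unfold couplingCost
  induction c with
  | nil => simp
  | cons a c ih =>
    simp only [List.map_cons, List.foldr_cons, max_le_iff, ih, List.forall_mem_cons]
    tauto

theorem FrechetReachable.mono {s : ℝ} {b : Fin P × Fin Q} (h : FrechetReachable p q r b)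
    (hrs : r ≤ s) : FrechetReachable p q s b := by
  obtain ⟨c, h0, hb, hc, hd⟩ := h
  exact ⟨c, h0, hb, hc, fun z hz => (hd z hz).trans hrs⟩

theorem FrechetReachable.step {a b : Fin P × Fin Q} (h : FrechetReachable p q r a)
    (hab : FrechetStep a b) (hb : dist (p b.1) (q b.2) ≤ r) : FrechetReachable p q r b := by
  obtain ⟨c, ⟨x, hx, hx0⟩, ha, hc, hd⟩ := h
  refine ⟨c ++ [b], ⟨x, ?_, hx0⟩, by simp, ?_, ?_⟩
  · simp_all [List.head?_append]
  · rw [List.isChain_append]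
    refine ⟨hc, List.isChain_singleton b, ?_⟩
    simp_all
  · intro z hz
    rcases List.mem_append.1 hz with hz | hz
    · exact hd z hz
    · rw [List.mem_singleton.1 hz]
      exact hb

namespace IsFrechetTable

theorem dist_le (hM : IsFrechetTable p q M) (b : Fin P × Fin Q) :
    dist (p b.1) (q b.2) ≤ M b.1 b.2 := by
  obtain ⟨⟨_ | i, hi⟩, ⟨_ | j, hj⟩⟩ := b
  · exact (hM.corner hi hj).ge
  · exact (le_max_right _ _).trans (hM.top j hi hj).ge
  · exact (le_max_right _ _).trans (hM.left i hi hj).ge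
  · exact (le_max_right _ _).trans (hM.inner i j hi hj).ge

theorem le_of_step (hM : IsFrechetTable p q M) {a b : Fin P × Fin Q}
    (hab : FrechetStep a b) : M b.1 b.2 ≤ max (M a.1 a.2) (dist (p b.1) (q b.2)) := by
  obtain ⟨⟨k, hk⟩, ⟨l, hl⟩⟩ := a
  obtain ⟨⟨i, hi⟩, ⟨j, hj⟩⟩ := b
  simp only [FrechetStep] at hab
  rcases hab with ⟨rfl, rfl⟩ | ⟨rfl, rfl⟩ | ⟨rfl, rfl⟩
  · cases j with
    | zero => exact (hM.left k hi hj).le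
    | succ j =>
      exact (hM.inner k j hi hj).le.trans (max_le_max_right _ (min_le_left _ _))
  · cases i with
    | zero => exact (hM.top l hi hj).le
    | succ i =>
      exact (hM.inner i l hi hj).le.trans
        (max_le_max_right _ ((min_le_right _ _).trans (min_le_right _ _)))
  · exact (hM.inner k l hi hj).le.trans
      (max_le_max_right _ ((min_le_right _ _).trans (min_le_left _ _)))

theorem le_of_isChain (hM : IsFrechetTable p q M) {c : List (Fin P × Fin Q)}
    {x y : Fin P × Fin Q} (hc : (x :: c).IsChain FrechetStep)
    (hy : (x :: c).getLast? = some y) (hx : M x.1 x.2 ≤ r)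
    (hd : ∀ z ∈ c, dist (p z.1) (q z.2) ≤ r) : M y.1 y.2 ≤ r := by
  induction c generalizing x with
  | nil =>
    obtain rfl : x = y := by simpa using hy
    exact hx
  | cons a c ih =>
    rw [List.isChain_cons_cons] at hc
    rw [List.getLast?_cons_cons] at hy
    rw [List.forall_mem_cons] at hd
    exact ih hc.2 hy ((hM.le_of_step hc.1).trans (max_le hx hd.1)) hd.2

theorem reachable_step (hM : IsFrechetTable p q M) {a b : Fin P × Fin Q}
    (ha : FrechetReachable p q (M a.1 a.2) a) (hab : FrechetStep a b)
    (h : M a.1 a.2 ≤ M b.1 b.2) : FrechetReachable p q (M b.1 b.2) b :=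
  (ha.mono h).step hab (hM.dist_le b)

theorem reachable (hM : IsFrechetTable p q M) (i j : ℕ) (hi : i < P) (hj : j < Q) :
    FrechetReachable p q (M i j) (⟨i, hi⟩, ⟨j, hj⟩) := by
  induction i generalizing j with
  | zero =>
    induction j with
    | zero => exact ⟨[(⟨0, hi⟩, ⟨0, hj⟩)], by simp, by simp, by simp, by simp [hM.corner hi hj]⟩
    | succ j ih =>
      exact hM.reachable_step (ih (by omega)) (by simp [FrechetStep])
        ((le_max_left _ _).trans (hM.top j hi hj).ge)
  | succ i ihi =>
    induction j with
    | zero =>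
      exact hM.reachable_step (ihi 0 (by omega) hj) (by simp [FrechetStep])
        ((le_max_left _ _).trans (hM.left i hi hj).ge)
    | succ j ihj =>
      have h := (le_max_left _ _).trans (hM.inner i j hi hj).ge
      rw [min_le_iff, min_le_iff] at h
      rcases h with h | h | h
      · exact hM.reachable_step (ihi (j + 1) (by omega) hj) (by simp [FrechetStep]) h
      · exact hM.reachable_step (ihi j (by omega) (by omega)) (by simp [FrechetStep]) h
      · exact hM.reachable_step (ihj (by omega)) (by simp [FrechetStep]) h

theorem eq_discreteFrechet (hM : IsFrechetTable p q M) (hP : 1 ≤ P) (hQ : 1 ≤ Q) :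
    M (P - 1) (Q - 1) = discreteFrechet p q := by
  have lower : ∀ c : List (Fin P × Fin Q), IsCoupling c →
      M (P - 1) (Q - 1) ≤ couplingCost p q c := by
    rintro c ⟨⟨x, hx, hx1, hx2⟩, ⟨y, hy, hy1, hy2⟩, hc⟩
    have hd := (couplingCost_le_iff (p := p) (q := q) (c := c)).1 le_rfl
    cases c with
    | nil => simp at hx
    | cons a c =>
      obtain rfl : a = x := by simpa using hx
      rw [← hy1, ← hy2]
      have hd' := List.forall_mem_cons.1 hd.2
      refine hM.le_of_isChain hc hy (le_trans ?_ hd'.1) hd'.2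
      obtain ⟨⟨i, hi⟩, ⟨j, hj⟩⟩ := a
      obtain rfl : i = 0 := hx1
      obtain rfl : j = 0 := hx2
      exact (hM.corner hi hj).le
  obtain ⟨c, h0, hb, hc, hd⟩ := hM.reachable (P - 1) (Q - 1) (by omega) (by omega)
  have hcoup : IsCoupling c := ⟨h0, ⟨_, hb, rfl, rfl⟩, hc⟩
  have hcost : couplingCost p q c ≤ M (P - 1) (Q - 1) :=
    couplingCost_le_iff.2 ⟨dist_nonneg.trans (hd _ (List.mem_of_getLast? hb)), hd⟩
  have hleast : IsLeast { r | ∃ c, IsCoupling c ∧ couplingCost p q c = r }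
      (M (P - 1) (Q - 1)) := by
    refine ⟨⟨c, hcoup, hcost.antisymm (lower c hcoup)⟩, ?_⟩
    rintro _ ⟨c, hc, rfl⟩
    exact lower c hc
  exact hleast.csInf_eq.symm

theorem first_row_le_iff (hM : IsFrechetTable p q M) (hP : 0 < P) {j : ℕ} (hj : j < Q) :
    M 0 j ≤ r ↔ ∀ k : Fin Q, (k : ℕ) ≤ j → dist (p ⟨0, hP⟩) (q k) ≤ r := by
  induction j with
  | zero =>
    rw [hM.corner hP hj]
    refine ⟨fun h k hk => ?_, fun h => h ⟨0, hj⟩ le_rfl⟩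
    obtain rfl : k = ⟨0, hj⟩ := Fin.ext (Nat.le_zero.1 hk)
    exact h
  | succ j ih =>
    rw [hM.top j hP hj, max_le_iff, ih (by omega)]
    refine ⟨fun h k hk => ?_, fun h => ⟨fun k hk => h k (by omega), h _ le_rfl⟩⟩
    rcases Nat.le_succ_iff.1 hk with hk | hk
    · exact h.1 k hk
    · obtain rfl : k = ⟨j + 1, hj⟩ := Fin.ext hk
      exact h.2

end IsFrechetTable

end

/-- The linear-memory row-update iteration computes the
dynamic-programming matrix row by row: `v i j = M i j` for all `i < P`, `j < Q`;
in particular `v (P-1) (Q-1)` equals the discrete Fréchet distance. -/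
theorem frechet_linear_memory_correct {E : Type*} [MetricSpace E] {P Q : ℕ}
    (hP : 1 ≤ P) (hQ : 1 ≤ Q) (p : Fin P → E) (q : Fin Q → E)
    (M v : ℕ → ℕ → ℝ)
    -- the dynamic-programming matrix
    (hM00 : M 0 0 = dist (p ⟨0, hP⟩) (q ⟨0, hQ⟩))
    (hMi0 : ∀ i, (hi : i + 1 < P) →
      M (i + 1) 0 = max (M i 0) (dist (p ⟨i + 1, hi⟩) (q ⟨0, hQ⟩)))
    (hM0j : ∀ j, (hj : j + 1 < Q) →
      M 0 (j + 1) = max (M 0 j) (dist (p ⟨0, hP⟩) (q ⟨j + 1, hj⟩)))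
    (hMij : ∀ i j, (hi : i + 1 < P) → (hj : j + 1 < Q) →
      M (i + 1) (j + 1) =
        max (min (M i (j + 1)) (min (M i j) (M (i + 1) j)))
          (dist (p ⟨i + 1, hi⟩) (q ⟨j + 1, hj⟩))) :
    -- the row vectors: `v i j` is the `j`-th entry of the `i`-th row `v⁽ⁱ⁾`
    (∀ j, (hj : j < Q) →
      v 0 j = (Finset.Iic (⟨j, hj⟩ : Fin Q)).sup'
        ⟨⟨j, hj⟩, Finset.mem_Iic.mpr le_rfl⟩ (fun k => dist (p ⟨0, hP⟩) (q k))) →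
    (∀ i, (hi : i + 1 < P) →
      v (i + 1) 0 = max (v i 0) (dist (p ⟨i + 1, hi⟩) (q ⟨0, hQ⟩))) →
    (∀ i j, (hi : i + 1 < P) → (hj : j + 1 < Q) →
      v (i + 1) (j + 1) =
        max (min (v (i + 1) j) (min (v i j) (v i (j + 1))))
          (dist (p ⟨i + 1, hi⟩) (q ⟨j + 1, hj⟩))) →
    ((∀ i, i < P → ∀ j, j < Q → v i j = M i j) ∧
      v (P - 1) (Q - 1) = discreteFrechet p q) := by
  intro hv0 hvi0 hvij
  have hM : IsFrechetTable p q M :=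
    ⟨fun _ _ => hM00, fun i hi _ => hMi0 i hi, fun j _ hj => hM0j j hj, hMij⟩
  have hvM : ∀ i, i < P → ∀ j, j < Q → v i j = M i j := by
    intro i
    induction i with
    | zero =>
      intro hi j hj
      refine eq_of_forall_ge_iff fun r => ?_
      rw [hv0 j hj, hM.first_row_le_iff hP hj]
      refine (Finset.sup'_le_iff _ _).trans ?_
      simp only [Finset.mem_Iic, Fin.le_def]
    | succ i ihi =>
      intro hi j
      induction j with
      | zero =>
        intro hj
        rw [hvi0 i hi, hMi0 i hi, ihi (by omega) 0 hj]
      | succ j ihj =>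
        intro hj
        rw [hvij i j hi hj, hMij i j hi hj, ihj (by omega), ihi (by omega) j (by omega),
          ihi (by omega) (j + 1) hj, min_comm (M i (j + 1)), min_comm (M i j) (M (i + 1) j),
          min_assoc]
  refine ⟨hvM, ?_⟩
  rw [hvM _ (by omega) _ (by omega), hM.eq_discreteFrechet hP hQ]
end

section
/- The continuous Fréchet distance between the polygonal curves through p and q is bounded above by the discrete Fréchet distance of the vertex sequences: δ_F(f_p, f_q) ≤ δ_dF(p,q), where f_p and f_q are the uniformly parametrized piecewise-linear curves through p and q. -/
/-- A reparametrization: a continuous, monotone nondecreasing surjection of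
`[0,1]` onto itself. -/
def IsReparam (α : ℝ → ℝ) : Prop :=
  ContinuousOn α (Set.Icc 0 1) ∧ MonotoneOn α (Set.Icc 0 1) ∧
  Set.MapsTo α (Set.Icc 0 1) (Set.Icc 0 1) ∧
  Set.SurjOn α (Set.Icc 0 1) (Set.Icc 0 1)

/-- The continuous Fréchet distance between two curves `f g : [0,1] → E`:
the infimum over pairs of reparametrizations of the supremum of pointwise
distances. -/
noncomputable def frechetDist {E : Type*} [MetricSpace E] (f g : ℝ → E) : ℝ :=
  sInf { r | ∃ α β : ℝ → ℝ, IsReparam α ∧ IsReparam β ∧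
    r = ⨆ t : Set.Icc (0 : ℝ) 1, dist (f (α t.1)) (g (β t.1)) }

/-- The uniformly parametrized piecewise-linear curve through the points of
`p`: for `t ∈ [i/(P-1), (i+1)/(P-1)]` it is the affine interpolation
`(1-s) • p i + s • p (i+1)` with `s = (P-1)·t - i`. -/
noncomputable def polyline {E : Type*} [NormedAddCommGroup E] [NormedSpace ℝ E]
    {P : ℕ} (hP : 2 ≤ P) (p : Fin P → E) (t : ℝ) : E :=
  (1 - (((P : ℝ) - 1) * t - (min ⌊((P : ℝ) - 1) * t⌋₊ (P - 2) : ℕ))) •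
      p ⟨min ⌊((P : ℝ) - 1) * t⌋₊ (P - 2), by omega⟩ +
    (((P : ℝ) - 1) * t - (min ⌊((P : ℝ) - 1) * t⌋₊ (P - 2) : ℕ)) •
      p ⟨min ⌊((P : ℝ) - 1) * t⌋₊ (P - 2) + 1, by omega⟩

open Set

/-- The piecewise-linear function taking the value `a k` at each natural number `k ≤ n`. -/
noncomputable def linearInterp (a : ℕ → ℝ) (n : ℕ) (s : ℝ) : ℝ :=
  a 0 + ∑ k ∈ Finset.range n, (a (k + 1) - a k) * max 0 (min 1 (s - k))

theorem linearInterp_add (a : ℕ → ℝ) {n k : ℕ} (hk : k < n) {τ : ℝ} (h0 : 0 ≤ τ) (h1 : τ ≤ 1) :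
    linearInterp a n (k + τ) = a k + τ * (a (k + 1) - a k) := by
  have h : ∀ m, k + 1 ≤ m → linearInterp a m (k + τ) = a k + τ * (a (k + 1) - a k) := by
    intro m hm
    induction m, hm using Nat.le_induction with
    | base =>
      have hs : ∑ j ∈ Finset.range k, (a (j + 1) - a j) * max 0 (min 1 ((k : ℝ) + τ - j)) =
          ∑ j ∈ Finset.range k, (a (j + 1) - a j) := by
        refine Finset.sum_congr rfl fun j hj => ?_
        have hj' : (j : ℝ) + 1 ≤ k := by exact_mod_cast Finset.mem_range.1 hj
        rw [min_eq_left (by linarith), max_eq_right zero_le_one, mul_one]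
      rw [linearInterp, Finset.sum_range_succ, hs, Finset.sum_range_sub, add_sub_cancel_left,
        min_eq_right h1, max_eq_right h0]
      ring
    | succ m hm ih =>
      have hm' : (k : ℝ) + 1 ≤ m := by exact_mod_cast hm
      rw [linearInterp, Finset.sum_range_succ, ← add_assoc, ← linearInterp, ih,
        max_eq_left ((min_le_right _ _).trans (by linarith)), mul_zero, add_zero]
  exact h n hk

theorem continuous_linearInterp (a : ℕ → ℝ) (n : ℕ) : Continuous (linearInterp a n) := by
  unfold linearInterp
  fun_prop

theorem monotone_linearInterp {a : ℕ → ℝ} {n : ℕ} (ha : ∀ k < n, a k ≤ a (k + 1)) :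
    Monotone (linearInterp a n) := by
  intro s t hst
  unfold linearInterp
  gcongr with k hk
  exact sub_nonneg.2 (ha k (Finset.mem_range.1 hk))

theorem isReparam_of_monotone {α : ℝ → ℝ} (hc : Continuous α) (hm : Monotone α)
    (h0 : α 0 = 0) (h1 : α 1 = 1) : IsReparam α := by
  refine ⟨hc.continuousOn, hm.monotoneOn _, fun t ht => ⟨?_, ?_⟩, ?_⟩
  · exact h0 ▸ hm ht.1
  · exact h1 ▸ hm ht.2
  · have := intermediate_value_Icc zero_le_one hc.continuousOn
    rwa [h0, h1] at this

theorem isReparam_linearInterp {a : ℕ → ℝ} {n : ℕ} (hn : 0 < n)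
    (ha : ∀ k < n, a k ≤ a (k + 1)) (h0 : a 0 = 0) (h1 : a n = 1) :
    IsReparam fun t => linearInterp a n (n * t) := by
  refine isReparam_of_monotone ((continuous_linearInterp a n).comp (by fun_prop))
    (fun s t hst => monotone_linearInterp ha (by gcongr)) ?_ ?_
  · simpa [h0] using linearInterp_add a hn le_rfl zero_le_one
  · obtain ⟨m, rfl⟩ : ∃ m, n = m + 1 := ⟨n - 1, by omega⟩
    simpa [h1] using linearInterp_add a m.lt_succ_self zero_le_one le_rfl

theorem polyline_segment {E : Type*} [NormedAddCommGroup E] [NormedSpace ℝ E]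
    {P : ℕ} (hP : 2 ≤ P) (p : Fin P → E) {k : ℕ} (hk : k + 1 < P) {s : ℝ}
    (h0 : 0 ≤ s) (h1 : s ≤ 1) :
    polyline hP p ((k + s) / ((P : ℝ) - 1)) =
      (1 - s) • p ⟨k, by omega⟩ + s • p ⟨k + 1, hk⟩ := by
  have hP' : (P : ℝ) - 1 ≠ 0 := by
    have : (2 : ℝ) ≤ P := by exact_mod_cast hP
    linarith
  have key : ∀ u : ℝ, ∀ m : ℕ, ∀ hm : m + 1 < P, u = k + s → min ⌊u⌋₊ (P - 2) = m →
      polyline hP p (u / ((P : ℝ) - 1)) =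
        (1 - (u - m)) • p ⟨m, by omega⟩ + (u - m) • p ⟨m + 1, hm⟩ := by
    intro u m hm hu hmin
    subst hmin
    simp only [polyline, mul_div_cancel₀ u hP']
  rcases h1.lt_or_eq with h1 | rfl
  · have hf : ⌊(k : ℝ) + s⌋₊ = k := by
      rw [Nat.floor_eq_iff (by positivity)]
      constructor <;> linarith
    rw [key _ k hk rfl (by omega)]
    simp
  · have hf : ⌊(k : ℝ) + 1⌋₊ = k + 1 := by exact_mod_cast Nat.floor_natCast (k + 1)
    by_cases hk' : k + 2 < P
    · rw [key _ (k + 1) hk' rfl (by omega)]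
      simp
    · rw [key _ k hk rfl (by omega)]
      simp

theorem polyline_interp {E : Type*} [NormedAddCommGroup E] [NormedSpace ℝ E]
    {P : ℕ} (hP : 2 ≤ P) (p : Fin P → E) {i j : Fin P}
    (hij : (j : ℕ) = i ∨ (j : ℕ) = i + 1) {s : ℝ} (h0 : 0 ≤ s) (h1 : s ≤ 1) :
    polyline hP p ((i : ℝ) / ((P : ℝ) - 1) +
      s * ((j : ℝ) / ((P : ℝ) - 1) - (i : ℝ) / ((P : ℝ) - 1))) =
      (1 - s) • p i + s • p j := by
  obtain ⟨i, hi⟩ := i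
  obtain ⟨j, hj⟩ := j
  dsimp only at hij
  rcases hij with rfl | rfl
  · rw [sub_self, mul_zero, add_zero, ← add_smul, sub_add_cancel, one_smul]
    by_cases hj' : j + 1 < P
    · simpa using polyline_segment hP p hj' le_rfl zero_le_one
    · obtain ⟨m, rfl⟩ : ∃ m, j = m + 1 := ⟨j - 1, by omega⟩
      simpa using polyline_segment hP p hj zero_le_one le_rfl
  · rw [← polyline_segment hP p hj h0 h1]
    congr 1
    push_cast
    ring

theorem dist_interp_le {E : Type*} [NormedAddCommGroup E] [NormedSpace ℝ E] {a b c d : E}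
    {s r : ℝ} (h0 : 0 ≤ s) (h1 : s ≤ 1) (hac : dist a c ≤ r) (hbd : dist b d ≤ r) :
    dist ((1 - s) • a + s • b) ((1 - s) • c + s • d) ≤ r := by
  have h1' : 0 ≤ 1 - s := sub_nonneg.2 h1
  calc dist ((1 - s) • a + s • b) ((1 - s) • c + s • d)
      ≤ dist ((1 - s) • a) ((1 - s) • c) + dist (s • b) (s • d) := dist_add_add_le _ _ _ _
    _ = (1 - s) * dist a c + s * dist b d := by
      rw [dist_smul₀, dist_smul₀, Real.norm_of_nonneg h0, Real.norm_of_nonneg h1']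
    _ ≤ (1 - s) * r + s * r := by gcongr
    _ = r := by ring

theorem FrechetStep.fst {P Q : ℕ} {a b : Fin P × Fin Q} (h : FrechetStep a b) :
    (b.1 : ℕ) = a.1 ∨ (b.1 : ℕ) = a.1 + 1 := by
  unfold FrechetStep at h
  omega

theorem FrechetStep.snd {P Q : ℕ} {a b : Fin P × Fin Q} (h : FrechetStep a b) :
    (b.2 : ℕ) = a.2 ∨ (b.2 : ℕ) = a.2 + 1 := by
  unfold FrechetStep at h
  omega

theorem frechetDist_le {E : Type*} [MetricSpace E] {f g : ℝ → E} {α β : ℝ → ℝ} {r : ℝ}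
    (hα : IsReparam α) (hβ : IsReparam β)
    (h : ∀ t ∈ Icc (0 : ℝ) 1, dist (f (α t)) (g (β t)) ≤ r) : frechetDist f g ≤ r := by
  have : Nonempty (Icc (0 : ℝ) 1) := ⟨⟨0, by simp⟩⟩
  refine le_trans (csInf_le ⟨0, ?_⟩ ⟨α, β, hα, hβ, rfl⟩) (ciSup_le fun t => h t t.2)
  rintro _ ⟨α, β, -, -, rfl⟩
  exact Real.iSup_nonneg fun _ => dist_nonneg

theorem isReparam_of_index_steps {P n : ℕ} (hP : 2 ≤ P) (hn : 0 < n) {i : ℕ → Fin P}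
    (h0 : (i 0 : ℕ) = 0) (h1 : (i n : ℕ) = P - 1)
    (hi : ∀ k < n, (i (k + 1) : ℕ) = i k ∨ (i (k + 1) : ℕ) = i k + 1) :
    IsReparam fun t => linearInterp (fun k => ((i k : ℕ) : ℝ) / ((P : ℝ) - 1)) n (n * t) := by
  have hP' : (0 : ℝ) < (P : ℝ) - 1 := by
    have : (2 : ℝ) ≤ P := by exact_mod_cast hP
    linarith
  refine isReparam_linearInterp hn (fun k hk => ?_) (by simp [h0]) ?_
  · have : (i k : ℕ) ≤ i (k + 1) := by have := hi k hk; omega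
    gcongr
  · rw [h1, Nat.cast_sub (by omega), Nat.cast_one, div_self hP'.ne']

theorem frechetDist_polyline_le_of_steps {E : Type*} [NormedAddCommGroup E] [NormedSpace ℝ E]
    {P Q : ℕ} (hP : 2 ≤ P) (hQ : 2 ≤ Q) (p : Fin P → E) (q : Fin Q → E) {n : ℕ}
    {x : ℕ → Fin P × Fin Q} {r : ℝ} (h0 : ((x 0).1 : ℕ) = 0 ∧ ((x 0).2 : ℕ) = 0)
    (h1 : ((x n).1 : ℕ) = P - 1 ∧ ((x n).2 : ℕ) = Q - 1)
    (hx : ∀ k < n, FrechetStep (x k) (x (k + 1)))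
    (hr : ∀ k ≤ n, dist (p (x k).1) (q (x k).2) ≤ r) :
    frechetDist (polyline hP p) (polyline hQ q) ≤ r := by
  have hn : 0 < n := by
    rcases n.eq_zero_or_pos with rfl | h
    · omega
    · exact h
  refine frechetDist_le
    (isReparam_of_index_steps hP hn (i := fun k => (x k).1) h0.1 h1.1 fun k hk => (hx k hk).fst)
    (isReparam_of_index_steps hQ hn (i := fun k => (x k).2) h0.2 h1.2 fun k hk => (hx k hk).snd)
    fun t ht => ?_
  obtain ⟨k, hk, τ, hτ0, hτ1, hτ⟩ :
      ∃ k < n, ∃ τ : ℝ, 0 ≤ τ ∧ τ ≤ 1 ∧ (n : ℝ) * t = k + τ := by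
    have hnt : 0 ≤ (n : ℝ) * t := mul_nonneg n.cast_nonneg ht.1
    rcases ht.2.lt_or_eq with h | rfl
    · refine ⟨⌊(n : ℝ) * t⌋₊, ?_, n * t - ⌊(n : ℝ) * t⌋₊, ?_, ?_, by ring⟩
      · rw [Nat.floor_lt hnt]
        exact mul_lt_of_lt_one_right (by exact_mod_cast hn) h
      · exact sub_nonneg.2 (Nat.floor_le hnt)
      · linarith [Nat.lt_floor_add_one ((n : ℝ) * t)]
    · exact ⟨n - 1, by omega, 1, zero_le_one, le_rfl, by
        rw [Nat.cast_sub (by omega)]; push_cast; ring⟩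
  rw [hτ, linearInterp_add _ hk hτ0 hτ1, linearInterp_add _ hk hτ0 hτ1,
    polyline_interp hP p (hx k hk).fst hτ0 hτ1, polyline_interp hQ q (hx k hk).snd hτ0 hτ1]
  exact dist_interp_le hτ0 hτ1 (hr k hk.le) (hr (k + 1) hk)

theorem dist_le_couplingCost {E : Type*} [MetricSpace E] {P Q : ℕ} (p : Fin P → E)
    (q : Fin Q → E) {c : List (Fin P × Fin Q)} {x : Fin P × Fin Q} (hx : x ∈ c) :
    dist (p x.1) (q x.2) ≤ couplingCost p q c := by
  induction c with
  | nil => simp at hx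
  | cons y c ih =>
    simp only [couplingCost, List.map_cons, List.foldr_cons] at ih ⊢
    rcases List.mem_cons.1 hx with rfl | hx
    · exact le_max_left _ _
    · exact (ih hx).trans (le_max_right _ _)

theorem reflTransGen_frechetStep {P Q : ℕ} (hP : 0 < P) (hQ : 0 < Q) {a b : ℕ}
    (ha : a < P) (hb : b < Q) :
    Relation.ReflTransGen FrechetStep ((⟨0, hP⟩, ⟨0, hQ⟩) : Fin P × Fin Q)
      (⟨a, ha⟩, ⟨b, hb⟩) := by
  induction a with
  | zero =>
    induction b with
    | zero => exact .refl
    | succ b ih => exact (ih (by omega)).tail (by simp [FrechetStep])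
  | succ a ih => exact (ih (by omega)).tail (by simp [FrechetStep])

theorem exists_isCoupling {P Q : ℕ} (hP : 0 < P) (hQ : 0 < Q) :
    ∃ c : List (Fin P × Fin Q), IsCoupling c := by
  obtain ⟨l, hl, hlast⟩ := List.exists_isChain_cons_of_relationReflTransGen
    (reflTransGen_frechetStep hP hQ (Nat.sub_one_lt_of_lt hP) (Nat.sub_one_lt_of_lt hQ))
  exact ⟨_, ⟨_, rfl, rfl, rfl⟩,
    ⟨_, by rw [List.getLast?_eq_getLast_of_ne_nil (List.cons_ne_nil _ _), hlast]; rfl, rfl, rfl⟩, hl⟩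

/-- The continuous Fréchet distance between the polygonal
curves through `p` and `q` is bounded above by the discrete Fréchet distance of
the vertex sequences. -/
theorem frechetDist_le_discreteFrechet {E : Type*}
    [NormedAddCommGroup E] [NormedSpace ℝ E] {P Q : ℕ}
    (hP : 2 ≤ P) (hQ : 2 ≤ Q) (p : Fin P → E) (q : Fin Q → E) :
    frechetDist (polyline hP p) (polyline hQ q) ≤ discreteFrechet p q := by
  obtain ⟨l₀, hl₀⟩ := exists_isCoupling (P := P) (Q := Q) (by omega) (by omega)
  refine le_csInf ⟨_, l₀, hl₀, rfl⟩ ?_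
  rintro _ ⟨l, ⟨⟨x, hx, hx0⟩, ⟨y, hy, hy1⟩, hchain⟩, rfl⟩
  have hlen : 0 < l.length := by
    cases l with
    | nil => simp at hx
    | cons => simp
  have hget : ∀ k (hk : k < l.length), l.getD k x = l[k] := fun k hk => by simp [hk]
  refine frechetDist_polyline_le_of_steps hP hQ p q (n := l.length - 1) (x := fun k => l.getD k x)
    ?_ ?_ (fun k hk => ?_) (fun k hk => ?_)
  · have : l[0]? = some x := by rw [← List.head?_eq_getElem?]; exact hx
    simpa [List.getD, this] using hx0
  · have : l[l.length - 1]? = some y := by rw [← List.getLast?_eq_getElem?]; exact hy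
    simpa [List.getD, this] using hy1
  · rw [hget k (by omega), hget (k + 1) (by omega)]
    exact List.isChain_iff_getElem.1 hchain k (by omega)
  · rw [hget k (by omega)]
    exact dist_le_couplingCost p q (List.getElem_mem _)
end

section
/- The discrete Fréchet distance exceeds the continuous Fréchet distance of the corresponding polygonal curves by at most the larger sampling width: δ_dF(p,q) ≤ δ_F(f_p, f_q) + max{ε_p, ε_q}, where ε_p = max_{i < P−1} dist(p_i, p_{i+1}) and ε_q = max_{j < Q−1} dist(q_j, q_{j+1}) are the largest distances between adjacent points of p and q, and f_p, f_q are the uniformly parametrized piecewise-linear curves through p and q. -/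
lemma IsReparam.map_zero {α : ℝ → ℝ} (h : IsReparam α) : α 0 = 0 := by
  obtain ⟨-, hm, hmaps, hs⟩ := h
  have h0 : (0 : ℝ) ∈ Set.Icc (0 : ℝ) 1 := by simp
  obtain ⟨x, hx, hx0⟩ := hs h0
  exact le_antisymm ((hm h0 hx hx.1).trans hx0.le) (hmaps h0).1

lemma IsReparam.map_one {α : ℝ → ℝ} (h : IsReparam α) : α 1 = 1 := by
  obtain ⟨-, hm, hmaps, hs⟩ := h
  have h1 : (1 : ℝ) ∈ Set.Icc (0 : ℝ) 1 := by simp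
  obtain ⟨x, hx, hx1⟩ := hs h1
  exact le_antisymm (hmaps h1).2 (hx1.symm.le.trans (hm hx h1 hx.2))

lemma isReparam_id : IsReparam id :=
  ⟨continuousOn_id, monotoneOn_id, Set.mapsTo_id _, Set.surjOn_id _⟩

lemma couplingCost_nonneg {E : Type*} [MetricSpace E] {P Q : ℕ}
    (p : Fin P → E) (q : Fin Q → E) (c : List (Fin P × Fin Q)) :
    0 ≤ couplingCost p q c := by
  induction c with
  | nil => simp [couplingCost]
  | cons a c ih => exact le_max_of_le_right ih

lemma couplingCost_le {E : Type*} [MetricSpace E] {P Q : ℕ}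
    {p : Fin P → E} {q : Fin Q → E} {c : List (Fin P × Fin Q)} {r : ℝ} (hr : 0 ≤ r)
    (h : ∀ x ∈ c, dist (p x.1) (q x.2) ≤ r) : couplingCost p q c ≤ r := by
  induction c with
  | nil => simpa [couplingCost] using hr
  | cons a c ih =>
    exact max_le (h a (by simp)) (ih fun x hx => h x (by simp [hx]))

lemma discreteFrechet_le_couplingCost {E : Type*} [MetricSpace E] {P Q : ℕ}
    (p : Fin P → E) (q : Fin Q → E) {c : List (Fin P × Fin Q)} (hc : IsCoupling c) :
    discreteFrechet p q ≤ couplingCost p q c := by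
  refine csInf_le ⟨0, ?_⟩ ⟨c, hc, rfl⟩
  rintro _ ⟨c, -, rfl⟩
  exact couplingCost_nonneg p q c

/-- If the index pairs satisfying `G` contain the first pair, and each of them other than the last
pair has a legal successor in `G`, then some coupling runs inside `G`. -/
lemma exists_isCoupling_of_step {P Q : ℕ} {G : Fin P × Fin Q → Prop}
    {a₀ : Fin P × Fin Q} (h₀ : G a₀) (h₁ : (a₀.1 : ℕ) = 0) (h₂ : (a₀.2 : ℕ) = 0)
    (hstep : ∀ a, G a → ¬ ((a.1 : ℕ) = P - 1 ∧ (a.2 : ℕ) = Q - 1) →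
      ∃ b, G b ∧ FrechetStep a b) :
    ∃ c, IsCoupling c ∧ ∀ x ∈ c, G x := by
  suffices H : ∀ n : ℕ, ∀ a : Fin P × Fin Q, G a → (P - a.1) + (Q - a.2) ≤ n →
      ∃ l : List (Fin P × Fin Q), (∃ y ∈ (a :: l).getLast?, (y.1 : ℕ) = P - 1 ∧
        (y.2 : ℕ) = Q - 1) ∧ List.IsChain FrechetStep (a :: l) ∧ ∀ x ∈ a :: l, G x by
    obtain ⟨l, hl, hch, hG⟩ := H _ a₀ h₀ le_rfl
    exact ⟨a₀ :: l, ⟨⟨a₀, by simp, h₁, h₂⟩, hl, hch⟩, hG⟩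
  intro n
  induction n with
  | zero =>
    intro a _ hn
    have := a.1.isLt
    omega
  | succ n ih =>
    intro a ha hn
    by_cases hend : (a.1 : ℕ) = P - 1 ∧ (a.2 : ℕ) = Q - 1
    · exact ⟨[], ⟨a, by simp, hend⟩, by simp, by simpa using ha⟩
    · obtain ⟨b, hb, hab⟩ := hstep a ha hend
      have hlt : (P - b.1) + (Q - b.2) ≤ n := by
        have := a.1.isLt
        have := a.2.isLt
        rcases hab with h | h | h <;> omega
      obtain ⟨l, ⟨y, hy, hyl⟩, hch, hG⟩ := ih b hb hlt
      refine ⟨b :: l, ⟨y, by simpa using hy, hyl⟩, List.isChain_cons_cons.2 ⟨hab, hch⟩, ?_⟩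
      intro x hx
      rcases List.mem_cons.1 hx with rfl | hx
      · exact ha
      · exact hG x hx

/-- Rounding two continuous monotone functions to nearest integers, simultaneously, yields
a coupling. -/
lemma exists_isCoupling_near {P Q : ℕ} (hP : 1 ≤ P) (hQ : 1 ≤ Q) {u v : ℝ → ℝ}
    (hu : ContinuousOn u (Set.Icc 0 1)) (hv : ContinuousOn v (Set.Icc 0 1))
    (hum : MonotoneOn u (Set.Icc 0 1)) (hvm : MonotoneOn v (Set.Icc 0 1))
    (hu0 : u 0 = 0) (hv0 : v 0 = 0) (hu1 : u 1 = (P : ℝ) - 1) (hv1 : v 1 = (Q : ℝ) - 1) :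
    ∃ c : List (Fin P × Fin Q), IsCoupling c ∧ ∀ x ∈ c, ∃ t ∈ Set.Icc (0 : ℝ) 1,
      |u t - (x.1 : ℕ)| ≤ 1 / 2 ∧ |v t - (x.2 : ℕ)| ≤ 1 / 2 := by
  let G : Fin P × Fin Q → Prop := fun x => ∃ t ∈ Set.Icc (0 : ℝ) 1,
    (((x.1 : ℕ) : ℝ) - 1 / 2 ≤ u t ∧ u t < ((x.1 : ℕ) : ℝ) + 1 / 2) ∧
    (((x.2 : ℕ) : ℝ) - 1 / 2 ≤ v t ∧ v t < ((x.2 : ℕ) : ℝ) + 1 / 2)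
  suffices hstep : ∀ a, G a → ¬ ((a.1 : ℕ) = P - 1 ∧ (a.2 : ℕ) = Q - 1) →
      ∃ b, G b ∧ FrechetStep a b by
    obtain ⟨c, hc, hG⟩ := exists_isCoupling_of_step (a₀ := (⟨0, hP⟩, ⟨0, hQ⟩))
      ⟨0, by simp, by norm_num [hu0], by norm_num [hv0]⟩ rfl rfl hstep
    refine ⟨c, hc, fun x hx => ?_⟩
    obtain ⟨t, ht, ⟨h1, h2⟩, h3, h4⟩ := hG x hx
    refine ⟨t, ht, abs_le.2 ⟨?_, ?_⟩, abs_le.2 ⟨?_, ?_⟩⟩ <;> linarith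
  rintro ⟨⟨i, hi⟩, ⟨j, hj⟩⟩ ⟨t, ht, ⟨h1, h2⟩, h3, h4⟩ hend
  dsimp only at h1 h2 h3 h4 hend ⊢
  have hsub : Set.Icc t 1 ⊆ Set.Icc (0 : ℝ) 1 := Set.Icc_subset_Icc_left ht.1
  have hcont : ContinuousOn (fun s => max (u s - (i + 1 / 2)) (v s - (j + 1 / 2)))
      (Set.Icc t 1) :=
    ((hu.mono hsub).sub continuousOn_const).sup ((hv.mono hsub).sub continuousOn_const)
  have hone : (0 : ℝ) ≤ max (u 1 - (i + 1 / 2)) (v 1 - (j + 1 / 2)) := by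
    rw [le_max_iff, hu1, hv1]
    rcases not_and_or.1 hend with h | h
    · left
      have : ((i + 2 : ℕ) : ℝ) ≤ P := by exact_mod_cast (by omega : i + 2 ≤ P)
      push_cast at this
      linarith
    · right
      have : ((j + 2 : ℕ) : ℝ) ≤ Q := by exact_mod_cast (by omega : j + 2 ≤ Q)
      push_cast at this
      linarith
  obtain ⟨s, hs, hs0⟩ := intermediate_value_Icc ht.2 hcont
    ⟨max_le (by linarith) (by linarith), hone⟩
  dsimp only at hs0
  have hus : u s ≤ i + 1 / 2 := by
    linarith [le_max_left (u s - (i + 1 / 2)) (v s - (j + 1 / 2))]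
  have hvs : v s ≤ j + 1 / 2 := by
    linarith [le_max_right (u s - (i + 1 / 2)) (v s - (j + 1 / 2))]
  have hut : u t ≤ u s := hum ht (hsub hs) hs.1
  have hvt : v t ≤ v s := hvm ht (hsub hs) hs.1
  have hus1 : u s ≤ P - 1 := hu1 ▸ hum (hsub hs) (by simp) hs.2
  have hvs1 : v s ≤ Q - 1 := hv1 ▸ hvm (hsub hs) (by simp) hs.2
  have hiP : u s = i + 1 / 2 → i + 1 < P := fun h => by
    have : ((i + 1 : ℕ) : ℝ) < P := by push_cast; linarith
    exact_mod_cast this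
  have hjQ : v s = j + 1 / 2 → j + 1 < Q := fun h => by
    have : ((j + 1 : ℕ) : ℝ) < Q := by push_cast; linarith
    exact_mod_cast this
  rcases hus.lt_or_eq with hu' | hu' <;> rcases hvs.lt_or_eq with hv' | hv'
  · exact absurd hs0 (max_lt (by linarith) (by linarith)).ne
  · refine ⟨(⟨i, hi⟩, ⟨j + 1, hjQ hv'⟩), ⟨s, hsub hs, ⟨?_, ?_⟩, ?_, ?_⟩, by simp [FrechetStep]⟩ <;>
      push_cast <;> linarith
  · refine ⟨(⟨i + 1, hiP hu'⟩, ⟨j, hj⟩), ⟨s, hsub hs, ⟨?_, ?_⟩, ?_, ?_⟩, by simp [FrechetStep]⟩ <;>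
      push_cast <;> linarith
  · refine ⟨(⟨i + 1, hiP hu'⟩, ⟨j + 1, hjQ hv'⟩), ⟨s, hsub hs, ⟨?_, ?_⟩, ?_, ?_⟩,
      by simp [FrechetStep]⟩ <;> push_cast <;> linarith

section Polyline

variable {E : Type*} [NormedAddCommGroup E] [NormedSpace ℝ E] {P : ℕ}

lemma polyline_eq_segment (hP : 2 ≤ P) (p : Fin P → E) {t : ℝ} (ht : t ∈ Set.Icc (0 : ℝ) 1) :
    ∃ (k : ℕ) (hk : k + 1 < P), ((P : ℝ) - 1) * t - k ∈ Set.Icc (0 : ℝ) 1 ∧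
      polyline hP p t = (1 - (((P : ℝ) - 1) * t - k)) • p ⟨k, by omega⟩ +
        (((P : ℝ) - 1) * t - k) • p ⟨k + 1, hk⟩ := by
  have hP' : (2 : ℝ) ≤ P := by exact_mod_cast hP
  have hu0 : 0 ≤ ((P : ℝ) - 1) * t := mul_nonneg (by linarith) ht.1
  have hu1 : ((P : ℝ) - 1) * t ≤ P - 1 := mul_le_of_le_one_right (by linarith) ht.2
  refine ⟨min ⌊((P : ℝ) - 1) * t⌋₊ (P - 2), by omega, ⟨?_, ?_⟩, rfl⟩
  · have : ((min ⌊((P : ℝ) - 1) * t⌋₊ (P - 2) : ℕ) : ℝ) ≤ ⌊((P : ℝ) - 1) * t⌋₊ := by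
      exact_mod_cast min_le_left _ _
    linarith [Nat.floor_le hu0]
  · rcases min_cases ⌊((P : ℝ) - 1) * t⌋₊ (P - 2) with ⟨h, -⟩ | ⟨h, -⟩ <;> rw [h]
    · linarith [Nat.lt_floor_add_one (((P : ℝ) - 1) * t)]
    · rw [Nat.cast_sub hP]
      push_cast
      linarith

lemma norm_polyline_le (hP : 2 ≤ P) (p : Fin P → E) {t : ℝ} (ht : t ∈ Set.Icc (0 : ℝ) 1) :
    ‖polyline hP p t‖ ≤ ∑ i, ‖p i‖ := by
  obtain ⟨k, hk, hs, h⟩ := polyline_eq_segment hP p ht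
  have hle (i : Fin P) : p i ∈ Metric.closedBall (0 : E) (∑ i, ‖p i‖) :=
    mem_closedBall_zero_iff.2 <|
      Finset.single_le_sum (f := fun i => ‖p i‖) (fun _ _ => norm_nonneg _) (Finset.mem_univ i)
  rw [h]
  exact mem_closedBall_zero_iff.1 <| convex_closedBall (0 : E) _ (hle _) (hle _)
    (sub_nonneg.2 hs.2) hs.1 (sub_add_cancel _ _)

lemma dist_polyline_le (hP : 2 ≤ P) (p : Fin P → E) {ε : ℝ}
    (hε : ∀ (k : ℕ) (hk : k + 1 < P), dist (p ⟨k, by omega⟩) (p ⟨k + 1, hk⟩) ≤ ε)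
    {t : ℝ} (ht : t ∈ Set.Icc (0 : ℝ) 1) (i : Fin P)
    (hi : |((P : ℝ) - 1) * t - (i : ℕ)| ≤ 1 / 2) :
    dist (polyline hP p t) (p i) ≤ ε / 2 := by
  obtain ⟨k, hk, hs, h⟩ := polyline_eq_segment hP p ht
  obtain ⟨i, hiP⟩ := i
  rw [h]
  dsimp only at hi
  rw [abs_le] at hi
  have hd := hε k hk
  have hd0 := dist_nonneg (x := p ⟨k, by omega⟩) (y := p ⟨k + 1, hk⟩)
  generalize ((P : ℝ) - 1) * t = u at *
  have h1 : i < k + 2 := by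
    have : (i : ℝ) < (k + 2 : ℕ) := by push_cast; linarith [hs.2]
    exact_mod_cast this
  have h2 : k < i + 1 := by
    have : (k : ℝ) < (i + 1 : ℕ) := by push_cast; linarith [hs.1]
    exact_mod_cast this
  rw [← AffineMap.lineMap_apply_module]
  obtain rfl | rfl : i = k ∨ i = k + 1 := by omega
  · rw [dist_lineMap_left, Real.norm_of_nonneg hs.1]
    nlinarith
  · push_cast at hi
    rw [dist_lineMap_right, Real.norm_of_nonneg (sub_nonneg.2 hs.2)]
    nlinarith

end Polyline

/-- Comparison of the two distances when adjacent points of both sequences are `ε`-close. -/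
lemma discreteFrechet_le_frechetDist_add {E : Type*}
    [NormedAddCommGroup E] [NormedSpace ℝ E] {P Q : ℕ}
    (hP : 2 ≤ P) (hQ : 2 ≤ Q) (p : Fin P → E) (q : Fin Q → E) {ε : ℝ}
    (hp : ∀ (k : ℕ) (hk : k + 1 < P), dist (p ⟨k, by omega⟩) (p ⟨k + 1, hk⟩) ≤ ε)
    (hq : ∀ (k : ℕ) (hk : k + 1 < Q), dist (q ⟨k, by omega⟩) (q ⟨k + 1, hk⟩) ≤ ε) :
    discreteFrechet p q ≤ frechetDist (polyline hP p) (polyline hQ q) + ε := by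
  rw [← sub_le_iff_le_add]
  refine le_csInf ⟨_, id, id, isReparam_id, isReparam_id, rfl⟩ ?_
  rintro _ ⟨α, β, hα, hβ, rfl⟩
  rw [sub_le_iff_le_add]
  have hbdd : BddAbove (Set.range fun t : Set.Icc (0 : ℝ) 1 =>
      dist (polyline hP p (α t.1)) (polyline hQ q (β t.1))) := by
    refine ⟨(∑ i, ‖p i‖) + ∑ j, ‖q j‖, ?_⟩
    rintro _ ⟨t, rfl⟩
    exact (dist_le_norm_add_norm _ _).trans <| add_le_add
      (norm_polyline_le hP p (hα.2.2.1 t.2)) (norm_polyline_le hQ q (hβ.2.2.1 t.2))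
  have hP1 : (0 : ℝ) ≤ (P : ℝ) - 1 := sub_nonneg.2 (by exact_mod_cast (by omega : 1 ≤ P))
  have hQ1 : (0 : ℝ) ≤ (Q : ℝ) - 1 := sub_nonneg.2 (by exact_mod_cast (by omega : 1 ≤ Q))
  obtain ⟨c, hc, hnear⟩ := exists_isCoupling_near (P := P) (Q := Q) (by omega) (by omega)
    (u := fun t => ((P : ℝ) - 1) * α t) (v := fun t => ((Q : ℝ) - 1) * β t)
    (continuousOn_const.mul hα.1) (continuousOn_const.mul hβ.1)
    (fun _ hx _ hy hxy => mul_le_mul_of_nonneg_left (hα.2.1 hx hy hxy) hP1)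
    (fun _ hx _ hy hxy => mul_le_mul_of_nonneg_left (hβ.2.1 hx hy hxy) hQ1)
    (by simp [hα.map_zero]) (by simp [hβ.map_zero])
    (by simp [hα.map_one]) (by simp [hβ.map_one])
  refine (discreteFrechet_le_couplingCost p q hc).trans (couplingCost_le ?_ ?_)
  · exact add_nonneg (Real.iSup_nonneg fun _ => dist_nonneg)
      (dist_nonneg.trans (hp 0 (by omega)))
  · intro x hx
    obtain ⟨t, ht, h1, h2⟩ := hnear x hx
    have hf := dist_polyline_le hP p hp (hα.2.2.1 ht) x.1 h1
    have hg := dist_polyline_le hQ q hq (hβ.2.2.1 ht) x.2 h2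
    have hfg := le_ciSup hbdd ⟨t, ht⟩
    dsimp only at hfg
    rw [dist_comm] at hf
    have htri := dist_triangle4 (p x.1) (polyline hP p (α t)) (polyline hQ q (β t)) (q x.2)
    linarith

lemma dist_adjacent_le_of_sup'_le {E : Type*} [PseudoMetricSpace E] {P : ℕ} (hP : 2 ≤ P)
    {p : Fin P → E} {ε : ℝ}
    (hε : (Finset.univ : Finset (Fin (P - 1))).sup' ⟨⟨0, by omega⟩, Finset.mem_univ _⟩
      (fun i => dist (p ⟨(i : ℕ), by have := i.isLt; omega⟩)
                     (p ⟨(i : ℕ) + 1, by have := i.isLt; omega⟩)) ≤ ε)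
    (k : ℕ) (hk : k + 1 < P) : dist (p ⟨k, by omega⟩) (p ⟨k + 1, hk⟩) ≤ ε :=
  (Finset.sup'_le_iff _ _).1 hε ⟨k, by omega⟩ (Finset.mem_univ _)

/-- The discrete Fréchet distance exceeds the continuous
Fréchet distance of the corresponding polygonal curves by at most the larger
sampling width `max ε_p ε_q`, where `ε_p` (resp. `ε_q`) is the largest distance
between adjacent points of `p` (resp. `q`). -/
theorem discreteFrechet_le_frechetDist_add_width {E : Type*}
    [NormedAddCommGroup E] [NormedSpace ℝ E] {P Q : ℕ}
    (hP : 2 ≤ P) (hQ : 2 ≤ Q) (p : Fin P → E) (q : Fin Q → E) :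
    discreteFrechet p q ≤ frechetDist (polyline hP p) (polyline hQ q) +
      max
        ((Finset.univ : Finset (Fin (P - 1))).sup'
          ⟨⟨0, by omega⟩, Finset.mem_univ _⟩
          (fun i => dist (p ⟨(i : ℕ), by have := i.isLt; omega⟩)
                         (p ⟨(i : ℕ) + 1, by have := i.isLt; omega⟩)))
        ((Finset.univ : Finset (Fin (Q - 1))).sup'
          ⟨⟨0, by omega⟩, Finset.mem_univ _⟩
          (fun j => dist (q ⟨(j : ℕ), by have := j.isLt; omega⟩)
                         (q ⟨(j : ℕ) + 1, by have := j.isLt; omega⟩))) := by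
  exact discreteFrechet_le_frechetDist_add hP hQ p q
    (dist_adjacent_le_of_sup'_le hP (le_max_left _ _))
    (dist_adjacent_le_of_sup'_le hQ (le_max_right _ _))
end
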